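/- Let T be a finite tree with at least three vertices on which Player 1 has a winning strategy in Trail Trap. If T has a single central vertex c, then deg(c) = 3; if T has two central vertices c₁, c₂ with deg(c₁) ≥ deg(c₂), then deg(c₁) = 3 and deg(c₂) = 2. -/

import Mathlib

open SimpleGraph

/-- A valid partial play of Trail Trap: a list of moves (directed edges), where each
move is along an edge of `G`, no edge (as an unordered pair) is used twice, and each
player's moves form a trail (move `i+2` starts where move `i` ended). Moves at even
indices belong to Player 1 and moves at odd indices to Player 2. -/
def ValidPlay {V : Type*} (G : SimpleGraph V) (l : List (V × V)) : Prop :=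
  (∀ m ∈ l, G.Adj m.1 m.2) ∧
  (l.map (fun m => s(m.1, m.2))).Nodup ∧
  ∀ (i : ℕ) (h : i + 2 < l.length),
    (l.get ⟨i + 2, h⟩).1 = (l.get ⟨i, by omega⟩).2

/-- The play `l` follows strategy `σ` on all turns with index `≡ t (mod 2)`. -/
def FollowsAt {V : Type*} (σ : List (V × V) → V × V) (t : ℕ) (l : List (V × V)) : Prop :=
  ∀ (i : ℕ) (h : i < l.length), i % 2 = t → l.get ⟨i, h⟩ = σ (l.take i)

/-- Player 1 has a winning strategy in Trail Trap on `G`: a strategy `σ` for the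
even-indexed moves such that every `σ`-consistent valid play that cannot be
`σ`-consistently extended has odd length (i.e. Player 2 is the one stuck). -/
def P1Win {V : Type*} (G : SimpleGraph V) : Prop :=
  ∃ σ : List (V × V) → V × V, ∀ l : List (V × V),
    ValidPlay G l → FollowsAt σ 0 l →
    (∀ m : V × V, ¬ (ValidPlay G (l ++ [m]) ∧ FollowsAt σ 0 (l ++ [m]))) →
    l.length % 2 = 1

/-- Player 2 has a winning strategy in Trail Trap on `G`. -/
def P2Win {V : Type*} (G : SimpleGraph V) : Prop :=
  ∃ σ : List (V × V) → V × V, ∀ l : List (V × V),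
    ValidPlay G l → FollowsAt σ 1 l →
    (∀ m : V × V, ¬ (ValidPlay G (l ++ [m]) ∧ FollowsAt σ 1 (l ++ [m]))) →
    l.length % 2 = 0

/-- Player 1 has a winning strategy in Trail Trap on `G` whose first move is `u → v`. -/
def P1WinFrom {V : Type*} (G : SimpleGraph V) (u v : V) : Prop :=
  ∃ σ : List (V × V) → V × V, σ [] = (u, v) ∧ ∀ l : List (V × V),
    ValidPlay G l → FollowsAt σ 0 l →
    (∀ m : V × V, ¬ (ValidPlay G (l ++ [m]) ∧ FollowsAt σ 0 (l ++ [m]))) →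
    l.length % 2 = 1

/-- Player 2 has a winning strategy in Trail Trap on `G`, given that Player 1's first
move was `u → v`. -/
def P2WinAfter {V : Type*} (G : SimpleGraph V) (u v : V) : Prop :=
  ∃ σ : List (V × V) → V × V, ∀ l : List (V × V),
    l.head? = some (u, v) → ValidPlay G l → FollowsAt σ 1 l →
    (∀ m : V × V, ¬ (ValidPlay G (l ++ [m]) ∧ FollowsAt σ 1 (l ++ [m]))) →
    l.length % 2 = 0

/-- The eccentricity of a vertex: the maximum distance to any vertex. -/
noncomputable def eccOf {V : Type*} [Fintype V] (G : SimpleGraph V) (v : V) : ℕ :=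
  Finset.univ.sup fun w => G.dist v w

/-- The radius of a graph: the minimum eccentricity. -/
noncomputable def radOf {V : Type*} [Fintype V] (G : SimpleGraph V) : ℕ :=
  sInf (Set.range (eccOf G))

/-- The diameter of a graph: the maximum eccentricity. -/
noncomputable def diamOf {V : Type*} [Fintype V] (G : SimpleGraph V) : ℕ :=
  Finset.univ.sup (eccOf G)

/-- A central vertex: one whose eccentricity equals the radius. -/
def IsCentral {V : Type*} [Fintype V] (G : SimpleGraph V) (v : V) : Prop :=
  eccOf G v = radOf G


/-- `x` lies in the branch behind the directed edge `p → q`. -/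
def Br {V : Type*} (T : SimpleGraph V) (p q x : V) : Prop :=
  T.dist p x = T.dist q x + 1

lemma br_or {V : Type*} {T : SimpleGraph V} (hT : T.IsTree) {p q : V} (h : T.Adj p q) (x : V) :
    Br T p q x ∨ Br T q p x := by
  have := hT.dist_eq_dist_add_one_of_adj x h
  unfold Br
  rw [T.dist_comm (u := p), T.dist_comm (u := q)]
  exact this

lemma br_not {V : Type*} {T : SimpleGraph V} {p q x : V} (h : Br T p q x) : ¬ Br T q p x := by
  unfold Br at *; omega

lemma br_self {V : Type*} {T : SimpleGraph V} {p q : V} (h : T.Adj p q) : Br T p q q := by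
  unfold Br; simp [SimpleGraph.dist_eq_one_iff_adj, h]

lemma not_br_self {V : Type*} {T : SimpleGraph V} {p q : V} : ¬ Br T p q p := by
  unfold Br; simp

lemma closer_unique {V : Type*} {T : SimpleGraph V} (hT : T.IsTree) {p x y y' : V}
    (h : T.Adj x y) (h' : T.Adj x y')
    (hd : T.dist p x = T.dist p y + 1) (hd' : T.dist p x = T.dist p y' + 1) : y = y' := by
  obtain ⟨w, hw⟩ := hT.connected.exists_walk_length_eq_dist p y
  obtain ⟨w', hw'⟩ := hT.connected.exists_walk_length_eq_dist p y'
  have h1 : (w.concat h.symm).IsPath :=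
    SimpleGraph.Walk.isPath_of_length_eq_dist _ (by simp [hw, hd])
  have h2 : (w'.concat h'.symm).IsPath :=
    SimpleGraph.Walk.isPath_of_length_eq_dist _ (by simp [hw', hd'])
  have h3 := (hT.existsUnique_path p x).unique h1 h2
  have := congrArg SimpleGraph.Walk.penultimate h3
  simpa using this

lemma exists_closer {V : Type*} {T : SimpleGraph V} (hT : T.IsTree) {x z : V}
    (h : 1 ≤ T.dist x z) : ∃ y, T.Adj x y ∧ T.dist x z = T.dist y z + 1 := by
  obtain ⟨w, hw⟩ := hT.connected.exists_walk_length_eq_dist x z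
  cases w with
  | nil => simp at h
  | cons hadj w' =>
    rename_i y
    refine ⟨y, hadj, ?_⟩
    have h1 := SimpleGraph.dist_le w'
    have h2 := hT.connected.dist_triangle (u := x) (v := y) (w := z)
    have h3 := SimpleGraph.dist_eq_one_iff_adj.2 hadj
    simp at hw
    omega

lemma br_adj {V : Type*} {T : SimpleGraph V} (hT : T.IsTree) {p q x y : V} (h : T.Adj p q)
    (hx : Br T p q x) (hxy : T.Adj x y) (hne : ¬ (x = q ∧ y = p)) : Br T p q y := by
  rcases br_or hT h y with hy | hy
  · exact hy
  exfalso
  unfold Br at *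
  have e1 := hT.dist_eq_dist_add_one_of_adj p hxy
  have e2 := hT.dist_eq_dist_add_one_of_adj q hxy
  have e3 : T.dist p x = T.dist p y + 1 := by omega
  rcases Nat.eq_zero_or_pos (T.dist q x) with h0 | h0
  · have hq := hT.connected.dist_eq_zero_iff.1 h0
    have h1 : T.dist p y = 0 := by omega
    have hp := hT.connected.dist_eq_zero_iff.1 h1
    exact hne ⟨hq.symm, hp.symm⟩
  · obtain ⟨y', hy', hd⟩ := exists_closer hT (x := x) (z := q) (by rw [T.dist_comm]; exact h0)
    rw [T.dist_comm, T.dist_comm (u := y')] at hd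
    have e4 := hT.dist_eq_dist_add_one_of_adj y' h
    rw [T.dist_comm, T.dist_comm (u := y') (v := q)] at e4
    have e5 := hT.dist_eq_dist_add_one_of_adj p hy'
    have := closer_unique hT hxy hy' e3 (by omega)
    subst this
    omega

/-- Distances across an edge. -/
lemma br_sep {V : Type*} {T : SimpleGraph V} (hT : T.IsTree) {p q : V} (h : T.Adj p q) :
    ∀ (n : ℕ) {x y : V}, T.dist x y = n → Br T p q x → Br T q p y →
      T.dist x q + 1 + T.dist p y ≤ T.dist x y := by
  intro n
  induction n with
  | zero =>
    intro x y hn hx hy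
    have := hT.connected.dist_eq_zero_iff.1 hn
    subst this
    exact absurd hy (br_not hx)
  | succ n ih =>
    intro x y hn hx hy
    obtain ⟨x', hx', hd⟩ := exists_closer hT (x := x) (z := y) (by omega)
    by_cases hc : x = q ∧ x' = p
    · obtain ⟨rfl, rfl⟩ := hc
      simp; omega
    · have hb := br_adj hT h hx hx' hc
      have := ih (x := x') (y := y) (by omega) hb hy
      have h2 := hT.connected.dist_triangle (u := x) (v := x') (w := q)
      have h3 := SimpleGraph.dist_eq_one_iff_adj.2 hx'
      omega

/-- The geodesic interval. -/
def Itv {V : Type*} (T : SimpleGraph V) (a b y : V) : Prop :=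
  T.dist a y + T.dist y b = T.dist a b

lemma itv_br {V : Type*} {T : SimpleGraph V} (hT : T.IsTree) {p q a b y : V} (h : T.Adj p q)
    (ha : Br T p q a) (hb : Br T p q b) (hy : Itv T a b y) : Br T p q y := by
  rcases br_or hT h y with h1 | h1
  · exact h1
  exfalso
  have s1 := br_sep hT h _ rfl ha h1
  have s2 := br_sep hT h _ rfl hb h1
  have t := hT.connected.dist_triangle (u := a) (v := q) (w := b)
  unfold Itv at hy
  rw [T.dist_comm (u := b) (v := y), T.dist_comm (u := b)] at s2
  omega

lemma itv_step {V : Type*} {T : SimpleGraph V} (hT : T.IsTree) {a a' b y : V} (h : T.Adj a a')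
    (hd : T.dist a b = T.dist a' b + 1) (hy : Itv T a' b y) : Itv T a b y := by
  unfold Itv at *
  have t := hT.connected.dist_triangle (u := a) (v := y) (w := b)
  have t2 := hT.connected.dist_triangle (u := a) (v := a') (w := y)
  have h3 := SimpleGraph.dist_eq_one_iff_adj.2 h
  omega

lemma br_disj {V : Type*} {T : SimpleGraph V} (hT : T.IsTree) {v w w' x : V} (h : T.Adj v w)
    (h' : T.Adj v w') (hx : Br T v w x) (hx' : Br T v w' x) : w = w' := by
  unfold Br at *
  rw [T.dist_comm, T.dist_comm (v := x)] at hx hx'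
  exact closer_unique hT h h' hx hx'

lemma br_sub {V : Type*} {T : SimpleGraph V} (hT : T.IsTree) {p q r x : V} (h : T.Adj p q)
    (h' : T.Adj q r) (hne : r ≠ p) (hx : Br T q r x) : Br T p q x := by
  rcases br_or hT h x with h1 | h1
  · exact h1
  exact absurd (br_disj hT h' h.symm hx h1) hne

lemma valid_snoc {V : Type*} {G : SimpleGraph V} {l : List (V × V)} {m : V × V} :
    ValidPlay G (l ++ [m]) ↔ ValidPlay G l ∧ G.Adj m.1 m.2 ∧
      (∀ m' ∈ l, s(m'.1, m'.2) ≠ s(m.1, m.2)) ∧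
      ∀ a b l', l = l' ++ [a, b] → m.1 = a.2 := by
  constructor
  · rintro ⟨h1, h2, h3⟩
    refine ⟨⟨fun m' hm' => h1 m' (by simp [hm']), ?_, ?_⟩, h1 m (by simp), ?_, ?_⟩
    · rw [List.map_append] at h2
      exact h2.of_append_left
    · intro i h
      have := h3 i (by simp; omega)
      simp only [List.get_eq_getElem] at *
      rwa [List.getElem_append_left (by omega), List.getElem_append_left (by omega)] at this
    · intro m' hm' he
      rw [List.map_append, List.nodup_append] at h2
      exact h2.2.2 _ (List.mem_map_of_mem hm') s(m.1, m.2) (by simp) he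
    · rintro a b l' rfl
      have := h3 l'.length (by simp)
      simpa using this
  · rintro ⟨⟨h1, h2, h3⟩, h4, h5, h6⟩
    refine ⟨?_, ?_, ?_⟩
    · intro m' hm'
      rcases List.mem_append.1 hm' with h | h
      · exact h1 _ h
      · simp at h; subst h; exact h4
    · rw [List.map_append, List.nodup_append]
      refine ⟨h2, by simp, ?_⟩
      intro e he e' he' hee
      simp at he'
      obtain ⟨m', hm', rfl⟩ := List.mem_map.1 he
      subst he'
      exact h5 m' hm' hee
    · intro i h
      simp only [List.get_eq_getElem]
      rcases Nat.lt_or_ge (i + 2) l.length with hi | hi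
      · rw [List.getElem_append_left (by omega), List.getElem_append_left (by omega)]
        exact h3 i hi
      · have hl : l.length = i + 2 := by simp at h; omega
        have hsplit : l = l.take i ++ [l[i], l[i+1]] := by
          apply List.ext_getElem
          · simp; omega
          · intro n hn hn'
            rcases Nat.lt_trichotomy n i with hh | hh | hh
            · rw [List.getElem_append_left (by simp; omega)]; simp
            · subst hh
              rw [List.getElem_append_right (by simp)]; simp [hl]
            · have : n = i + 1 := by omega
              subst this
              rw [List.getElem_append_right (by simp)]; simp [hl]
        have := h6 _ _ _ hsplit
        rw [List.getElem_append_right (by omega), List.getElem_append_left (by omega)]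
        simpa [hl] using this

lemma follows_snoc {V : Type*} {σ : List (V × V) → V × V} {l : List (V × V)} {m : V × V} :
    FollowsAt σ 0 (l ++ [m]) ↔ FollowsAt σ 0 l ∧ (l.length % 2 = 0 → m = σ l) := by
  constructor
  · intro h
    constructor
    · intro i hi hm
      have := h i (by simp; omega) hm
      simp only [List.get_eq_getElem] at *
      rw [List.getElem_append_left (by omega), List.take_append_of_le_length (by omega)] at this
      exact this
    · intro hl
      have := h l.length (by simp) hl
      simpa using this
  · rintro ⟨h1, h2⟩ i hi hm
    simp only [List.get_eq_getElem]
    rcases Nat.lt_or_ge i l.length with h | h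
    · rw [List.getElem_append_left (by omega), List.take_append_of_le_length (by omega)]
      exact h1 i h hm
    · have : i = l.length := by simp at hi; omega
      subst this
      simpa using h2 hm

/-- `σ` is a winning strategy for Player 1. -/
def Wins {V : Type*} (G : SimpleGraph V) (σ : List (V × V) → V × V) : Prop :=
  ∀ l : List (V × V), ValidPlay G l → FollowsAt σ 0 l →
    (∀ m : V × V, ¬ (ValidPlay G (l ++ [m]) ∧ FollowsAt σ 0 (l ++ [m]))) →
    l.length % 2 = 1

/-- A play consistent with `σ`. -/
def Good {V : Type*} (G : SimpleGraph V) (σ : List (V × V) → V × V) (l : List (V × V)) : Prop :=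
  ValidPlay G l ∧ FollowsAt σ 0 l

lemma p1_step {V : Type*} {G : SimpleGraph V} {σ : List (V × V) → V × V} (hσ : Wins G σ)
    {l : List (V × V)} (hl : Good G σ l) (he : l.length % 2 = 0) :
    ∃ m, Good G σ (l ++ [m]) := by
  by_contra hc
  push Not at hc
  have := hσ l hl.1 hl.2 hc
  omega

lemma p2_step {V : Type*} {G : SimpleGraph V} {σ : List (V × V) → V × V}
    {l : List (V × V)} {m : V × V} (hl : Good G σ l) (he : l.length % 2 = 1)
    (h : G.Adj m.1 m.2) (hu : ∀ m' ∈ l, s(m'.1, m'.2) ≠ s(m.1, m.2))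
    (hp : ∀ a b l', l = l' ++ [a, b] → m.1 = a.2) : Good G σ (l ++ [m]) :=
  ⟨valid_snoc.2 ⟨hl.1, h, hu, hp⟩, follows_snoc.2 ⟨hl.2, by omega⟩⟩

lemma race {V : Type*} {T : SimpleGraph V} (hT : T.IsTree) {σ : List (V × V) → V × V}
    (hσ : Wins T σ) (z : V) : ∀ (k : ℕ) (l : List (V × V)) (a b : V × V),
    Good T σ (l ++ [a, b]) → l.length % 2 = 0 →
    (∀ x, Br T a.1 a.2 x → T.dist a.2 x ≤ k) → k ≤ T.dist b.2 z →
    (∀ y, Itv T b.2 z y → ¬ Br T a.1 a.2 y) →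
    (∀ m ∈ l ++ [a, b], ¬ (Itv T b.2 z m.1 ∧ Itv T b.2 z m.2)) → False := by
  intro k
  induction k with
  | zero =>
    intro l a b hg he hk _ _ _
    obtain ⟨m, hm⟩ := p1_step hσ hg (by simp; omega)
    obtain ⟨_, h1, h2, h3⟩ := valid_snoc.1 hm.1
    have h4 := h3 a b l rfl
    have hab : T.Adj a.1 a.2 := hg.1.1 a (by simp)
    have h5 := br_adj hT hab (br_self hab) (y := m.2) (h4 ▸ h1) (by
      rintro ⟨-, h⟩
      apply h2 a (by simp)
      rw [h4, h, Sym2.eq_swap])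
    have h6 := hk _ h5
    have h7 := SimpleGraph.dist_eq_one_iff_adj.2 (h4 ▸ h1)
    omega
  | succ k ih =>
    intro l a b hg he hk hz hd hu
    obtain ⟨m, hm⟩ := p1_step hσ hg (by simp; omega)
    obtain ⟨_, h1, h2, h3⟩ := valid_snoc.1 hm.1
    have h4 := h3 a b l rfl
    have hab : T.Adj a.1 a.2 := hg.1.1 a (by simp)
    have h1' : T.Adj a.2 m.2 := h4 ▸ h1
    have hne : m.2 ≠ a.1 := by
      intro h
      apply h2 a (by simp)
      rw [h4, h, Sym2.eq_swap]
    obtain ⟨r, hr, hrd⟩ := exists_closer hT (x := b.2) (z := z) (by omega)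
    have hir : Itv T b.2 z r := by
      unfold Itv; rw [SimpleGraph.dist_eq_one_iff_adj.2 hr]; omega
    have hib : Itv T b.2 z b.2 := by unfold Itv; simp
    have hmb : ¬ Itv T b.2 z m.1 := by
      rw [h4]; intro h; exact hd _ h (br_self hab)
    have hg2 : Good T σ ((l ++ [a, b]) ++ [m] ++ [(b.2, r)]) := by
      apply p2_step hm (by simp; omega) hr
      · intro m' hm' heq
        rw [List.mem_append] at hm'
        rcases hm' with hm' | hm'
        · apply hu m' hm'
          rcases Sym2.eq_iff.1 heq with ⟨e1, e2⟩ | ⟨e1, e2⟩ <;> rw [e1, e2]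
          · exact ⟨hib, hir⟩
          · exact ⟨hir, hib⟩
        · simp at hm'
          subst hm'
          rcases Sym2.eq_iff.1 heq with ⟨e1, e2⟩ | ⟨e1, e2⟩ <;> rw [e1] at hmb
          · exact hmb hib
          · exact hmb hir
      · intro a' b' l' hl'
        have : l ++ [a, b] ++ [m] = (l ++ [a]) ++ [b, m] := by simp
        rw [this] at hl'
        have := (List.append_inj' hl' rfl).2
        simp at this
        rw [← this.1]
    rw [List.append_assoc] at hg2
    refine ih (l ++ [a, b]) m (b.2, r) hg2 (by simp; omega) ?_ ?_ ?_ ?_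
    · intro x hx
      rw [h4] at hx
      have := hk x (br_sub hT hab h1' hne hx)
      unfold Br at hx
      omega
    · simp; omega
    · intro y hy hby
      rw [h4] at hby
      exact hd y (itv_step hT hr hrd hy) (br_sub hT hab h1' hne hby)
    · intro m' hm' hc
      have hc' := And.intro (itv_step hT hr hrd hc.1) (itv_step hT hr hrd hc.2)
      rw [List.mem_append] at hm'
      rcases hm' with hm' | hm'
      · exact hu m' hm' hc'
      · simp at hm'
        rcases hm' with rfl | rfl
        · exact hmb hc'.1
        · have := hc.1
          unfold Itv at this
          simp at this
          omega

lemma structure_P1 {V : Type*} [Fintype V] {T : SimpleGraph V} (hT : T.IsTree)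
    (h3 : 3 ≤ Fintype.card V) {σ : List (V × V) → V × V} (hσ : Wins T σ) :
    ∃ (u v w w' x0 x1 : V) (H : ℕ), T.Adj u v ∧ T.Adj v w ∧ T.Adj v w' ∧ u ≠ w ∧ u ≠ w' ∧
      w ≠ w' ∧ 1 ≤ H ∧ (∀ x, Br T u v x → T.dist v x ≤ H) ∧ Br T v w x0 ∧ T.dist v x0 = H ∧
      Br T v w' x1 ∧ T.dist v x1 = H ∧
      (∀ s z, Br T v u s → Br T v u z → T.dist s z ≤ H) ∧
      ∀ y, T.Adj v y → y = u ∨ y = w ∨ y = w' := by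
  have hg0 : Good T σ [] := by
    refine ⟨⟨by simp, by simp, by simp⟩, ?_⟩
    intro i hi; simp at hi
  obtain ⟨⟨u, v⟩, hg1⟩ := p1_step hσ hg0 rfl
  simp only [List.nil_append] at hg1
  have huv : T.Adj u v := hg1.1.1 (u, v) (by simp)
  obtain ⟨x0, hx0, hmax⟩ := Set.exists_max_image {x | Br T u v x} (fun x => T.dist v x)
    (Set.toFinite _) ⟨v, br_self huv⟩
  simp only [Set.mem_ofPred_eq] at hx0 hmax
  obtain ⟨H, hH⟩ : ∃ H, T.dist v x0 = H := ⟨_, rfl⟩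
  rw [hH] at hmax
  -- (A)
  have hA : ∀ s z, Br T v u s → Br T v u z → T.dist s z ≤ H := by
    intro s z hs hz
    by_contra hc
    push Not at hc
    obtain ⟨r, hr, hrd⟩ := exists_closer hT (x := s) (z := z) (by omega)
    have hir : Itv T s z r := by
      unfold Itv; rw [SimpleGraph.dist_eq_one_iff_adj.2 hr]; omega
    have hbr := itv_br hT huv.symm hs hz hir
    have hg2 : Good T σ ([(u, v)] ++ [(s, r)]) := by
      apply p2_step hg1 rfl hr
      · intro m hm heq
        simp at hm; subst hm
        rcases Sym2.eq_iff.1 heq with ⟨e1, e2⟩ | ⟨e1, e2⟩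
        · exact not_br_self (show Br T v u v from (show v = r from e2) ▸ hbr)
        · exact not_br_self (show Br T v u v from (show v = s from e2) ▸ hs)
      · intro a b l' h
        have := congrArg List.length h
        simp at this
    refine race hT hσ z H [] (u, v) (s, r) hg2 rfl hmax (by simp; omega) ?_ ?_
    · intro y hy
      exact br_not (itv_br hT huv.symm hbr hz hy)
    · intro m hm hc
      simp at hm
      rcases hm with rfl | rfl
      · exact not_br_self (itv_br hT huv.symm hbr hz hc.2)
      · have := hc.1
        unfold Itv at this
        simp at this
        omega
  have hH1 : 1 ≤ H := by
    by_contra hc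
    have h0 : H = 0 := by omega
    subst h0
    have : ∀ x : V, x = u ∨ x = v := by
      intro x
      rcases br_or hT huv x with h | h
      · right
        exact (hT.connected.dist_eq_zero_iff.1 (Nat.le_zero.1 (hmax x h))).symm
      · left
        exact (hT.connected.dist_eq_zero_iff.1
          (Nat.le_zero.1 (hA u x (br_self huv.symm) h))).symm
    classical
    have h2 : (Finset.univ : Finset V) ⊆ {u, v} := by
      intro x _; simpa using this x
    have h4 := Finset.card_le_card h2
    have h5 := Finset.card_le_two (a := u) (b := v)
    rw [Finset.card_univ] at h4
    omega
  -- (B)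
  obtain ⟨w, hvw, hwd⟩ := exists_closer hT (x := v) (z := x0) (by omega)
  have hwx : Br T v w x0 := hwd
  have huw : u ≠ w := by
    rintro rfl
    unfold Br at hx0; omega
  have hg2 : Good T σ ([(u, v)] ++ [(v, w)]) := by
    apply p2_step hg1 rfl hvw
    · intro m hm heq
      simp at hm; subst hm
      rcases Sym2.eq_iff.1 heq with ⟨e1, e2⟩ | ⟨e1, e2⟩
      · exact huv.ne e1
      · exact huw e1
    · intro a b l' h
      have := congrArg List.length h
      simp at this
  obtain ⟨⟨v', w'⟩, hg3⟩ := p1_step hσ hg2 (by simp)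
  obtain ⟨_, hvw', hu3, hv'⟩ := valid_snoc.1 hg3.1
  have hv' := hv' (u, v) (v, w) [] rfl
  simp only at hv' hvw'
  subst hv'
  have huw' : u ≠ w' := by
    rintro rfl
    exact hu3 (u, v') (by simp) Sym2.eq_swap
  have hww' : w ≠ w' := by
    rintro rfl
    exact hu3 (v', w) (by simp) rfl
  have hx1 : ∃ x1, Br T v' w' x1 ∧ T.dist v' x1 = H := by
    by_contra hc
    push Not at hc
    have hlt : ∀ x, Br T v' w' x → T.dist w' x + 2 ≤ H := by
      intro x hx
      have h1 := hc x hx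
      have h2 := hmax x (br_sub hT huv hvw' huw'.symm hx)
      unfold Br at hx
      omega
    have hH2 := hlt w' (br_self hvw')
    simp at hH2
    obtain ⟨r, hr, hrd⟩ := exists_closer hT (x := w) (z := x0) (by omega)
    have hir : Itv T w x0 r := by
      unfold Itv; rw [SimpleGraph.dist_eq_one_iff_adj.2 hr]; omega
    have hbr := itv_br hT hvw (br_self hvw) hwx hir
    have hg4 : Good T σ ([(u, v')] ++ [(v', w)] ++ [(v', w')] ++ [(w, r)]) := by
      apply p2_step hg3 (by simp) hr
      · intro m hm heq
        have hnr : r ≠ v' := by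
          rintro rfl; exact not_br_self hbr
        have hnw : w ≠ v' := hvw.ne.symm
        have key : m.1 ≠ v' ∧ m.2 ≠ v' := by
          rcases Sym2.eq_iff.1 heq with ⟨e1, e2⟩ | ⟨e1, e2⟩ <;> rw [e1, e2]
          · exact ⟨hnw, hnr⟩
          · exact ⟨hnr, hnw⟩
        simp at hm
        rcases hm with rfl | rfl | rfl <;> simp at key
      · intro a b l' h
        have : [(u, v')] ++ [(v', w)] ++ [(v', w')] = [(u, v')] ++ [(v', w), (v', w')] := rfl
        rw [this] at h
        have := (List.append_inj' h rfl).2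
        simp at this
        rw [← this.1]
    refine race hT hσ x0 (H - 2) [(u, v'), (v', w)] (v', w') (w, r) hg4 (by simp) ?_ ?_ ?_ ?_
    · intro x hx
      have := hlt x hx
      simp; omega
    · simp; omega
    · intro y hy hb
      exact hww' (br_disj hT hvw hvw' (itv_br hT hvw hbr hwx hy) hb)
    · intro m hm hc
      have c1 := itv_br hT hvw hbr hwx hc.1
      have c2 := itv_br hT hvw hbr hwx hc.2
      simp at hm
      rcases hm with rfl | rfl | rfl | rfl
      · exact not_br_self c2
      · exact not_br_self c1
      · exact not_br_self c1
      · have := hc.1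
        unfold Itv at this
        simp at this
        omega
  obtain ⟨x1, hx1b, hx1d⟩ := hx1
  refine ⟨u, v', w, w', x0, x1, H, huv, hvw, hvw', huw, huw', hww', hH1, hmax, hwx, hH,
    hx1b, hx1d, hA, ?_⟩
  -- (C)
  intro y hvy
  by_contra hc
  push Not at hc
  obtain ⟨hyu, hyw, hyw'⟩ := hc
  have hg2' : Good T σ ([(u, v')] ++ [(y, v')]) := by
    apply p2_step hg1 rfl hvy.symm
    · intro m hm heq
      simp at hm; subst hm
      rcases Sym2.eq_iff.1 heq with ⟨e1, e2⟩ | ⟨e1, e2⟩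
      · exact hyu e1.symm
      · exact huv.ne e1
    · intro a b l' h
      have := congrArg List.length h
      simp at this
  obtain ⟨⟨v, t⟩, hg3'⟩ := p1_step hσ hg2' (by simp)
  obtain ⟨_, hvt, hu4, hv4⟩ := valid_snoc.1 hg3'.1
  have hv4 := hv4 (u, v') (y, v') [] rfl
  simp only at hv4 hvt
  subst hv4
  have hut : u ≠ t := by
    rintro rfl
    exact hu4 (u, v) (by simp) Sym2.eq_swap
  have hyt : y ≠ t := by
    rintro rfl
    exact hu4 (y, v) (by simp) Sym2.eq_swap
  have key : ∀ r x, T.Adj v r → u ≠ r → y ≠ r → t ≠ r → Br T v r x → T.dist v x = H → False := by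
    intro r x hr hur hyr htr hbr hxd
    have hg4 : Good T σ ([(u, v)] ++ [(y, v)] ++ [(v, t)] ++ [(v, r)]) := by
      apply p2_step hg3' (by simp) hr
      · intro m hm heq
        simp at hm
        rcases hm with rfl | rfl | rfl <;> simp at heq
        · rcases heq with ⟨e1, e2⟩ | e
          · exact huv.ne e1
          · exact hur e
        · rcases heq with ⟨e1, e2⟩ | e
          · exact hvy.ne e1.symm
          · exact hyr e
        · rcases heq with e | e
          · exact htr e
          · exact hr.ne e.1
      · intro a b l' h
        have : [(u, v)] ++ [(y, v)] ++ [(v, t)] = [(u, v)] ++ [(y, v), (v, t)] := rfl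
        rw [this] at h
        have := (List.append_inj' h rfl).2
        simp at this
        rw [← this.1]
    refine race hT hσ x (H - 1) [(u, v), (y, v)] (v, t) (v, r) hg4 (by simp) ?_ ?_ ?_ ?_
    · intro x hx
      have := hmax x (br_sub hT huv hvt hut.symm hx)
      unfold Br at hx
      simp at hx ⊢; omega
    · unfold Br at hbr
      simp; omega
    · intro y hy hb
      exact htr (br_disj hT hvt hr hb (itv_br hT hr (br_self hr) hbr hy))
    · intro m hm hc
      have c1 := itv_br hT hr (br_self hr) hbr hc.1
      have c2 := itv_br hT hr (br_self hr) hbr hc.2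
      simp at hm
      rcases hm with rfl | rfl | rfl | rfl
      · exact not_br_self c2
      · exact not_br_self c2
      · exact not_br_self c1
      · exact not_br_self c1
  by_cases htw : t = w
  · exact key w' x1 hvw' huw' hyw' (htw ▸ hww') hx1b hx1d
  · exact key w x0 hvw huw hyw htw hwx hH

lemma le_ecc {V : Type*} [Fintype V] (T : SimpleGraph V) (v w : V) : T.dist v w ≤ eccOf T v :=
  Finset.le_sup (f := fun w => T.dist v w) (Finset.mem_univ w)

lemma ecc_le {V : Type*} [Fintype V] (T : SimpleGraph V) (v : V) (n : ℕ)
    (h : ∀ w, T.dist v w ≤ n) : eccOf T v ≤ n :=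
  Finset.sup_le fun w _ => h w

lemma central_iff {V : Type*} [Fintype V] (T : SimpleGraph V) (v : V) (n : ℕ)
    (hv : eccOf T v = n) (h : ∀ w, n ≤ eccOf T w) (x : V) :
    IsCentral T x ↔ eccOf T x = n := by
  have : radOf T = n := by
    unfold radOf
    apply le_antisymm
    · exact Nat.sInf_le ⟨v, hv⟩
    · apply le_csInf (Set.range_nonempty_iff_nonempty.2 ⟨v⟩)
      rintro _ ⟨w, rfl⟩
      exact h w
  unfold IsCentral
  rw [this]

lemma center_cases {V : Type*} [Fintype V] [DecidableEq V] (T : SimpleGraph V)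
    [DecidableRel T.Adj] (hT : T.IsTree) (h3 : 3 ≤ Fintype.card V)
    (hwin : P1Win T) : ∃ u v : V, u ≠ v ∧ T.degree v = 3 ∧
      ((∀ x, IsCentral T x ↔ x = v) ∨
        ((∀ x, IsCentral T x ↔ (x = u ∨ x = v)) ∧ T.degree u = 2)) := by
  obtain ⟨σ, hσ⟩ := hwin
  obtain ⟨u, v, w, w', x0, x1, H, huv, hvw, hvw', huw, huw', hww', hH1, hmax, hx0, hx0d,
    hx1, hx1d, hA, hN⟩ := structure_P1 hT h3 hσ
  refine ⟨u, v, huv.ne, ?_, ?_⟩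
  · have : T.neighborFinset v = {u, w, w'} := by
      ext y
      simp only [SimpleGraph.mem_neighborFinset, Finset.mem_insert, Finset.mem_singleton]
      refine ⟨hN y, ?_⟩
      rintro (rfl | rfl | rfl)
      exacts [huv.symm, hvw, hvw']
    rw [← SimpleGraph.card_neighborFinset_eq_degree, this]
    exact Finset.card_eq_three.2 ⟨u, w, w', huw, huw', hww', rfl⟩
  have hfar : ∀ y, T.dist y v + H ≤ eccOf T y := by
    intro y
    have aux : ∀ r x, T.Adj v r → Br T v r x → T.dist v x = H → ¬ Br T v r y →
        T.dist y v + H ≤ eccOf T y := by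
      intro r x hr hx hd hy
      have h1 := (br_or hT hr y).resolve_left hy
      have h2 := br_sep hT hr.symm _ rfl h1 hx
      have h3 := le_ecc T y x
      unfold Br at hx
      omega
    by_cases hy : Br T v w y
    · exact aux w' x1 hvw' hx1 hx1d (fun h => hww' (br_disj hT hvw hvw' hy h))
    · exact aux w x0 hvw hx0 hx0d hy
  by_cases hg : ∀ x, Br T v u x → T.dist u x < H
  · left
    have hv : eccOf T v = H := by
      apply le_antisymm
      · apply ecc_le
        intro x
        rcases br_or hT huv x with h | h
        · exact hmax x h
        · have := hg x h
          unfold Br at h; omega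
      · have := hfar v; omega
    intro x
    rw [central_iff T v H hv (fun y => by have := hfar y; omega)]
    constructor
    · intro h
      have := hfar x
      exact hT.connected.dist_eq_zero_iff.1 (by omega)
    · rintro rfl; exact hv
  · right
    push Not at hg
    obtain ⟨x2, hx2, hx2d⟩ := hg
    have hx2d : T.dist u x2 = H := le_antisymm (hA u x2 (br_self huv.symm) hx2) hx2d
    have hx0' : Br T u v x0 := br_sub hT huv hvw huw.symm hx0
    have hv : eccOf T v = H + 1 := by
      apply le_antisymm
      · apply ecc_le
        intro x
        rcases br_or hT huv x with h | h
        · have := hmax x h; omega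
        · have := hA u x (br_self huv.symm) h
          unfold Br at h; omega
      · have := le_ecc T v x2
        unfold Br at hx2; omega
    have hu : eccOf T u = H + 1 := by
      apply le_antisymm
      · apply ecc_le
        intro x
        rcases br_or hT huv x with h | h
        · have := hmax x h; unfold Br at h; omega
        · have := hA u x (br_self huv.symm) h
          omega
      · have := le_ecc T u x0
        unfold Br at hx0'; omega
    have hfar2 : ∀ y, y ≠ u → y ≠ v → H + 2 ≤ eccOf T y := by
      intro y hyu hyv
      have p1 := hT.connected.pos_dist_of_ne hyu
      have p2 := hT.connected.pos_dist_of_ne hyv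
      rcases br_or hT huv y with h | h
      · have h2 := br_sep hT huv _ rfl h hx2
        have h3 := le_ecc T y x2
        omega
      · have h2 := br_sep hT huv.symm _ rfl h hx0'
        have h3 := le_ecc T y x0
        omega
    constructor
    · intro x
      rw [central_iff T v (H + 1) hv (fun y => by
        by_cases h1 : y = u
        · rw [h1, hu]
        by_cases h2 : y = v
        · rw [h2, hv]
        have := hfar2 y h1 h2; omega)]
      constructor
      · intro h
        by_contra hc
        push Not at hc
        have := hfar2 x hc.1 hc.2
        omega
      · rintro (rfl | rfl) <;> assumption
    · obtain ⟨t, hut, htd⟩ := exists_closer hT (x := u) (z := x2) (by omega)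
      have htv : t ≠ v := by
        rintro rfl
        unfold Br at hx2; omega
      have : T.neighborFinset u = {v, t} := by
        ext y
        simp only [SimpleGraph.mem_neighborFinset, Finset.mem_insert, Finset.mem_singleton]
        constructor
        · intro hy
          by_contra hc
          push Not at hc
          have hby : Br T v u y := br_adj hT huv.symm (br_self huv.symm) hy (fun h => hc.1 h.2)
          have hyt : ¬ Br T u t y := fun h => hc.2 (br_disj hT hy hut (br_self hy) h)
          have h1 := (br_or hT hut y).resolve_left hyt
          have h2 := br_sep hT hut.symm _ rfl h1 htd
          have h4 := hA y x2 hby hx2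
          have h5 := SimpleGraph.dist_eq_one_iff_adj.2 hy.symm
          omega
        · rintro (rfl | rfl)
          exacts [huv, hut]
      rw [← SimpleGraph.card_neighborFinset_eq_degree, this]
      exact Finset.card_pair htv.symm

/-- If `T` is a P1-win finite tree with at least three vertices, then: if `T` has a
single central vertex `c`, `deg c = 3`; and if `T` has two central vertices `c₁, c₂`
with `deg c₁ ≥ deg c₂`, then `deg c₁ = 3` and `deg c₂ = 2`. -/
theorem stmt_15 {V : Type*} [Fintype V] [DecidableEq V] (T : SimpleGraph V)
    [DecidableRel T.Adj] (hT : T.IsTree) (h3 : 3 ≤ Fintype.card V)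
    (hwin : P1Win T) :
    (∀ c : V, {v | IsCentral T v} = {c} → T.degree c = 3) ∧
    (∀ c₁ c₂ : V, c₁ ≠ c₂ → {v | IsCentral T v} = {c₁, c₂} →
      T.degree c₂ ≤ T.degree c₁ → T.degree c₁ = 3 ∧ T.degree c₂ = 2) := by
  obtain ⟨u, v, huv, hdv, h⟩ := center_cases T hT h3 hwin
  rcases h with h | ⟨h, hdu⟩
  · have hs : {x | IsCentral T x} = {v} := by ext x; simp [h x]
    refine ⟨?_, ?_⟩
    · intro c hc
      rw [hs] at hc
      rw [← Set.singleton_injective hc]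
      exact hdv
    · intro c₁ c₂ hne hc _
      rw [hs] at hc
      have e1 : c₁ ∈ ({v} : Set V) := by rw [hc]; simp
      have e2 : c₂ ∈ ({v} : Set V) := by rw [hc]; simp
      exact absurd (e1.trans e2.symm) hne
  · have hs : {x | IsCentral T x} = {u, v} := by ext x; simp [h x]
    refine ⟨?_, ?_⟩
    · intro c hc
      rw [hs] at hc
      have e1 : u ∈ ({c} : Set V) := by rw [← hc]; simp
      have e2 : v ∈ ({c} : Set V) := by rw [← hc]; simp
      exact absurd (e1.trans e2.symm) huv
    · intro c₁ c₂ hne hc hd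
      rw [hs] at hc
      have e1 : c₁ ∈ ({u, v} : Set V) := by rw [hc]; simp
      have e2 : c₂ ∈ ({u, v} : Set V) := by rw [hc]; simp
      rcases e1 with rfl | rfl <;> rcases e2 with rfl | rfl
      · exact absurd rfl hne
      · omega
      · exact ⟨hdv, hdu⟩
      · exact absurd rfl hne
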